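/- Let b, p be real numbers with p ∉ {−1, 0, 1} and p³ − bp² − 5p + b = 0. Then 4p⁴ − 3bp³ − 9p² + bp − 1 = (p² + 1)³/(p² − 1) and p(−5p³ + 4bp² + 15p − 2b) = −p²(p⁴ + 2p² + 5)/(p² − 1); in particular the product of these two quantities is strictly negative. -/

import Mathlib

/-- Proposition 10: at a root `p ∉ {−1,0,1}` of the cubic
`p³ − bp² − 5p + b`, the eigenvalues
`λ₁ = 4p⁴ − 3bp³ − 9p² + bp − 1` and `λ₂ = p(−5p³ + 4bp² + 15p − 2b)`
satisfy `λ₁ = (p²+1)³/(p²−1)` and `λ₂ = −p²(p⁴+2p²+5)/(p²−1)`;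
in particular `λ₁λ₂ < 0`. -/
theorem E34_nonzero_singularities_are_saddles (b p : ℝ)
    (hm1 : p ≠ -1) (h0 : p ≠ 0) (h1 : p ≠ 1)
    (hroot : p^3 - b*p^2 - 5*p + b = 0) :
    4*p^4 - 3*b*p^3 - 9*p^2 + b*p - 1 = (p^2 + 1)^3 / (p^2 - 1) ∧
    p*(-5*p^3 + 4*b*p^2 + 15*p - 2*b) = -(p^2*(p^4 + 2*p^2 + 5)) / (p^2 - 1) ∧
    (4*p^4 - 3*b*p^3 - 9*p^2 + b*p - 1) * (p*(-5*p^3 + 4*b*p^2 + 15*p - 2*b)) < 0 := by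
  have hd : p^2 - 1 ≠ 0 := by
    have h : (p - 1) * (p + 1) ≠ 0 :=
      mul_ne_zero (sub_ne_zero.mpr h1) (fun h => hm1 (by linarith))
    intro h'
    exact h (by linarith)
  have e1 : 4*p^4 - 3*b*p^3 - 9*p^2 + b*p - 1 = (p^2 + 1)^3 / (p^2 - 1) := by
    rw [eq_div_iff hd]
    linear_combination (3*p^3 - p) * hroot
  have e2 : p*(-5*p^3 + 4*b*p^2 + 15*p - 2*b) = -(p^2*(p^4 + 2*p^2 + 5)) / (p^2 - 1) := by
    rw [eq_div_iff hd]
    linear_combination (-p*(4*p^2 - 2)) * hroot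
  refine ⟨e1, e2, ?_⟩
  rw [e1, e2, div_mul_div_comm]
  apply div_neg_of_neg_of_pos
  · have : 0 < (p^2 + 1)^3 * (p^2*(p^4 + 2*p^2 + 5)) := by positivity
    linarith
  · exact mul_self_pos.mpr hd
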